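/- Let d ∈ ℕ with d ≥ 4. Then for every f ∈ l^2(ℤ^d) one has ‖ sup_{t ∈ 𝔻, t ≤ √d} |𝓜_t f| ‖_{l^2(ℤ^d)} ≤ 900 · ‖f‖_{l^2(ℤ^d)}. -/

import Mathlib

open Finset MeasureTheory
open scoped ENNReal NNReal

noncomputable section

/-- The lattice points of the closed `l¹` ball of radius `t` in `ℤ^d`,
i.e. `B_t ∩ ℤ^d` where `B_t = {x ∈ ℝ^d : Σ |x_i| ≤ t}`. -/
def latticeBall (d t : ℕ) : Finset (Fin d → ℤ) :=
  (Finset.Icc (fun _ => -(t : ℤ)) (fun _ => (t : ℤ))).filter fun y => ∑ i, |y i| ≤ (t : ℤ)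

/-- The discrete Hardy–Littlewood averaging operator over the `l¹` ball:
`𝓜_t f (x) = |B_t ∩ ℤ^d|⁻¹ Σ_{y ∈ B_t ∩ ℤ^d} f (x - y)`. -/
def Mop (d t : ℕ) (f : (Fin d → ℤ) → ℂ) (x : Fin d → ℤ) : ℂ :=
  ((latticeBall d t).card : ℂ)⁻¹ * ∑ y ∈ latticeBall d t, f (x - y)


theorem norm_sum_pow_apply_le {E : Type*} [NormedAddCommGroup E] [InnerProductSpace ℝ E]
    (T : Module.End ℝ E) (hsymm : ∀ k u v, inner ℝ ((T ^ k) u) v = inner ℝ u ((T ^ k) v))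
    (hnonneg : ∀ k u, 0 ≤ inner ℝ ((T ^ k) u) u)
    (hanti : ∀ k u, inner ℝ ((T ^ (k + 1)) u) u ≤ inner ℝ ((T ^ k) u) u)
    (h : ℕ → E) (hpos : ∀ k j, 0 ≤ inner ℝ ((T ^ k) (h k)) (h j)) (N : ℕ) :
    ‖∑ n ∈ range N, (T ^ n) (h n)‖ ≤ 2 * ‖∑ n ∈ range N, h n‖ := by
  have key : ∀ (Y : E) (n : ℕ),
      inner ℝ ((T ^ n) (∑ i ∈ range n, h i - Y)) (∑ i ∈ range n, h i - Y) ≤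
        inner ℝ Y Y - 2 * inner ℝ (∑ i ∈ range n, (T ^ i) (h i)) Y +
          ∑ k ∈ range n, inner ℝ ((T ^ k) (h k))
            (∑ i ∈ range (k + 1), h i + ∑ i ∈ range k, h i) := by
    intro Y n
    induction n with
    | zero => simp
    | succ n ih =>
      refine (hanti _ _).trans ?_
      rw [sum_range_succ _ n, sum_range_succ _ n, sum_range_succ _ n, sum_range_succ _ n]
      set H := ∑ i ∈ range n, h i
      have e : H + h n - Y = (H - Y) + h n := by abel
      have e2 : inner ℝ ((T ^ n) (H - Y)) (h n) = inner ℝ ((T ^ n) (h n)) (H - Y) := by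
        rw [hsymm, real_inner_comm]
      rw [e, map_add, inner_add_left, inner_add_right, inner_add_right, e2]
      have e3 : inner ℝ ((T ^ n) (h n)) (H - Y) =
          inner ℝ ((T ^ n) (h n)) H - inner ℝ ((T ^ n) (h n)) Y := inner_sub_right _ _ _
      have e4 : inner ℝ ((T ^ n) (h n)) (H + h n + H) = 2 * inner ℝ ((T ^ n) (h n)) H +
          inner ℝ ((T ^ n) (h n)) (h n) := by
        rw [inner_add_right, inner_add_right]; ring
      rw [e3, e4, inner_add_left]
      linarith
  set Y := ∑ n ∈ range N, (T ^ n) (h n) with hY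
  have h1 := (hnonneg N _).trans (key Y N)
  have h2 : ∑ k ∈ range N, inner ℝ ((T ^ k) (h k))
      (∑ i ∈ range (k + 1), h i + ∑ i ∈ range k, h i) ≤
      2 * inner ℝ Y (∑ n ∈ range N, h n) := by
    rw [hY, sum_inner, mul_sum]
    refine sum_le_sum fun k hk => ?_
    have hk := mem_range.1 hk
    have mono : ∀ m ≤ N, inner ℝ ((T ^ k) (h k)) (∑ i ∈ range m, h i) ≤
        inner ℝ ((T ^ k) (h k)) (∑ i ∈ range N, h i) := by
      intro m hm
      rw [inner_sum, inner_sum]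
      exact sum_le_sum_of_subset_of_nonneg (range_mono hm) fun j _ _ => hpos k j
    rw [inner_add_right]
    linarith [mono (k + 1) hk, mono k hk.le]
  have h3 : ‖Y‖ * ‖Y‖ ≤ 2 * ‖∑ n ∈ range N, h n‖ * ‖Y‖ := by
    have := real_inner_le_norm Y (∑ n ∈ range N, h n)
    rw [← hY] at h1
    rw [← real_inner_self_eq_norm_mul_norm]
    nlinarith
  by_contra! hlt
  have := (norm_nonneg (∑ n ∈ range N, h n))
  nlinarith

theorem exists_pow_le_norm_le {G : Type*} (P : Module.End ℝ (lp (fun _ : G => ℝ) 2))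
    (hsymm : ∀ u v, inner ℝ (P u) v = inner ℝ u (P v)) (hnorm : ∀ u, ‖P u‖ ≤ ‖u‖)
    (hpos : ∀ u : lp (fun _ : G => ℝ) 2, (∀ x, 0 ≤ u x) → ∀ x, 0 ≤ P u x)
    (f : lp (fun _ : G => ℝ) 2) (hf : ∀ x, 0 ≤ f x) (N : ℕ) :
    ∃ g : lp (fun _ : G => ℝ) 2,
      (∀ k < N, ∀ x, (((P ^ 2) ^ k) f) x ≤ g x) ∧ (∀ x, 0 ≤ g x) ∧ ‖g‖ ≤ 2 * ‖f‖ := by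
  rcases Nat.eq_zero_or_pos N with rfl | hN
  · exact ⟨0, by simp, fun x => by simp, by simp⟩
  have hsymm' : ∀ k u v, inner ℝ ((P ^ k) u) v = inner ℝ u ((P ^ k) v) := by
    intro k
    induction k with
    | zero => simp
    | succ k ih =>
      intro u v
      rw [pow_succ, Module.End.mul_apply, ih, hsymm, ← Module.End.mul_apply, ← pow_succ',
        ← pow_succ]
  have hpos' : ∀ k (u : lp (fun _ : G => ℝ) 2), (∀ x, 0 ≤ u x) → ∀ x, 0 ≤ (P ^ k) u x := by
    intro k
    induction k with
    | zero => simp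
    | succ k ih =>
      intro u hu
      rw [pow_succ', Module.End.mul_apply]
      exact hpos _ (ih u hu)
  have hinner : ∀ k u, inner ℝ (((P ^ 2) ^ k) u) u = ‖(P ^ k) u‖ ^ 2 := by
    intro k u
    rw [← pow_mul, two_mul, pow_add, Module.End.mul_apply, hsymm', real_inner_self_eq_norm_sq]
  have hsel : ∀ x, ∃ n ∈ range N, ∀ k ∈ range N, ((P ^ 2) ^ k) f x ≤ ((P ^ 2) ^ n) f x :=
    fun x => exists_max_image (range N) (fun k => ((P ^ 2) ^ k) f x) ⟨0, mem_range.2 hN⟩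
  choose sel hselN hselmax using hsel
  classical
  have hmem : ∀ n, Memℓp (fun x => if sel x = n then (((P ^ 2) ^ n) f) x else 0) 2 := by
    intro n
    have h := lp.memℓp (((P ^ 2) ^ n) f)
    rw [memℓp_gen_iff (by norm_num)] at h ⊢
    refine h.of_nonneg_of_le (fun x => by positivity) fun x => ?_
    split_ifs
    · rfl
    · simpa using sq_nonneg _
  let h : ℕ → lp (fun _ : G => ℝ) 2 := fun n => ⟨_, hmem n⟩
  have hh : ∀ n x, h n x = if sel x = n then (((P ^ 2) ^ n) f) x else 0 := fun _ _ => rfl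
  have hh0 : ∀ n x, 0 ≤ h n x := by
    intro n x
    rw [hh]
    split_ifs
    · rw [← pow_mul]; exact hpos' _ f hf x
    · rfl
  set g := ∑ n ∈ range N, h n with hg
  have hgx : ∀ x, g x = ((P ^ 2) ^ (sel x)) f x := by
    intro x
    rw [hg, lp.coeFn_sum, Finset.sum_apply]
    simp only [hh]
    rw [sum_ite_eq, if_pos (hselN x)]
  have hin : ∀ u v : lp (fun _ : G => ℝ) 2, (∀ x, 0 ≤ u x) → (∀ x, 0 ≤ v x) →
      0 ≤ inner ℝ u v := by
    intro u v hu hv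
    rw [lp.inner_eq_tsum]
    exact tsum_nonneg fun x => by simpa using mul_nonneg (hv x) (hu x)
  have hY := norm_sum_pow_apply_le (P ^ 2) (fun k u v => by rw [← pow_mul]; exact hsymm' _ u v)
    (fun k u => by rw [hinner]; positivity)
    (fun k u => by
      rw [hinner, hinner, pow_succ' P, Module.End.mul_apply]
      gcongr
      exact hnorm _)
    h (fun k j => hin _ _ (by rw [← pow_mul]; exact hpos' _ _ (hh0 k)) (hh0 j)) N
  rw [← hg] at hY
  refine ⟨g, fun k hk x => ?_, fun x => ?_, ?_⟩
  · rw [hgx]; exact hselmax x k (mem_range.2 hk)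
  · rw [hgx, ← pow_mul]; exact hpos' _ f hf x
  · have e : inner ℝ g g = inner ℝ (∑ n ∈ range N, ((P ^ 2) ^ n) (h n)) f := by
      conv_lhs => rw [hg, sum_inner]
      rw [sum_inner]
      refine sum_congr rfl fun n _ => ?_
      rw [← pow_mul, hsymm', pow_mul, lp.inner_eq_tsum, lp.inner_eq_tsum]
      refine tsum_congr fun x => ?_
      rw [← hg, hgx, hh]
      split_ifs with hs
      · rw [hs]
      · simp
    have h1 := real_inner_le_norm (∑ n ∈ range N, ((P ^ 2) ^ n) (h n)) f
    rw [← e, real_inner_self_eq_norm_mul_norm] at h1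
    by_contra! hlt
    nlinarith [norm_nonneg f, norm_nonneg g]

theorem memℓp_comp_sub {G : Type*} [AddCommGroup G] (v : G) {f : G → ℝ} (h : Memℓp f 2) :
    Memℓp (fun x => f (x - v)) 2 := by
  rw [memℓp_gen_iff (by norm_num)] at h ⊢
  exact (Equiv.subRight v).summable_iff.2 h

/-- Translation `f ↦ f (· - v)` on real-valued `ℓ²(G)`. -/
def lpTranslate {G : Type*} [AddCommGroup G] (v : G) : Module.End ℝ (lp (fun _ : G => ℝ) 2) where
  toFun f := ⟨fun x => f (x - v), memℓp_comp_sub v (lp.memℓp f)⟩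
  map_add' _ _ := rfl
  map_smul' _ _ := rfl

theorem lpTranslate_apply {G : Type*} [AddCommGroup G] (v : G) (f : lp (fun _ : G => ℝ) 2)
    (x : G) : lpTranslate v f x = f (x - v) := rfl

theorem inner_lpTranslate {G : Type*} [AddCommGroup G] (v : G) (f g : lp (fun _ : G => ℝ) 2) :
    inner ℝ (lpTranslate v f) g = inner ℝ f (lpTranslate (-v) g) := by
  rw [lp.inner_eq_tsum, lp.inner_eq_tsum, ← (Equiv.addRight v).tsum_eq]
  simp [lpTranslate_apply]

theorem norm_lpTranslate {G : Type*} [AddCommGroup G] (v : G) (f : lp (fun _ : G => ℝ) 2) :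
    ‖lpTranslate v f‖ = ‖f‖ := by
  have h : inner ℝ (lpTranslate v f) (lpTranslate v f) = inner ℝ f f := by
    rw [inner_lpTranslate]
    congr 1
    ext x
    simp [lpTranslate_apply]
  rw [real_inner_self_eq_norm_sq, real_inner_self_eq_norm_sq] at h
  exact (sq_eq_sq₀ (norm_nonneg _) (norm_nonneg _)).1 h

theorem exists_pow_le_norm_le_four {G : Type*} (P : Module.End ℝ (lp (fun _ : G => ℝ) 2))
    (hsymm : ∀ u v, inner ℝ (P u) v = inner ℝ u (P v)) (hnorm : ∀ u, ‖P u‖ ≤ ‖u‖)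
    (hpos : ∀ u : lp (fun _ : G => ℝ) 2, (∀ x, 0 ≤ u x) → ∀ x, 0 ≤ P u x)
    (f : lp (fun _ : G => ℝ) 2) (hf : ∀ x, 0 ≤ f x) (N : ℕ) :
    ∃ g : lp (fun _ : G => ℝ) 2,
      (∀ k < N, ∀ x, ((P ^ k) f) x ≤ g x) ∧ (∀ x, 0 ≤ g x) ∧ ‖g‖ ≤ 4 * ‖f‖ := by
  obtain ⟨g₁, h₁, h₁', h₁''⟩ := exists_pow_le_norm_le P hsymm hnorm hpos f hf N
  obtain ⟨g₂, h₂, h₂', h₂''⟩ := exists_pow_le_norm_le P hsymm hnorm hpos (P f) (hpos f hf) N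
  refine ⟨g₁ + g₂, fun k hk x => ?_, fun x => ?_, ?_⟩
  · rw [lp.coeFn_add, Pi.add_apply]
    rcases Nat.even_or_odd' k with ⟨m, rfl | rfl⟩
    · rw [pow_mul]
      linarith [h₁ m (by lia) x, h₂' x]
    · rw [pow_succ, pow_mul, Module.End.mul_apply]
      linarith [h₂ m (by lia) x, h₁' x]
  · exact add_nonneg (h₁' x) (h₂' x)
  · linarith [norm_add_le g₁ g₂, hnorm f]

/-- The sum of the translations by the `2 * d` unit vectors of `ℤ^d`. -/
def unitStepSum (d : ℕ) : Module.End ℝ (lp (fun _ : Fin d → ℤ => ℝ) 2) :=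
  ∑ i, (lpTranslate (Pi.single i 1) + lpTranslate (-Pi.single i 1))

theorem unitStepSum_apply {d : ℕ} (f : lp (fun _ : Fin d → ℤ => ℝ) 2) (x : Fin d → ℤ) :
    unitStepSum d f x = ∑ i, (f (x - Pi.single i 1) + f (x + Pi.single i 1)) := by
  rw [unitStepSum, LinearMap.sum_apply, lp.coeFn_sum, Finset.sum_apply]
  refine sum_congr rfl fun i _ => ?_
  rw [LinearMap.add_apply, lp.coeFn_add, Pi.add_apply, lpTranslate_apply, lpTranslate_apply,
    sub_neg_eq_add]

theorem inner_unitStepSum {d : ℕ} (f g : lp (fun _ : Fin d → ℤ => ℝ) 2) :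
    inner ℝ (unitStepSum d f) g = inner ℝ f (unitStepSum d g) := by
  simp only [unitStepSum, LinearMap.sum_apply, sum_inner, inner_sum, LinearMap.add_apply,
    inner_add_left, inner_add_right, inner_lpTranslate, neg_neg]
  exact sum_congr rfl fun i _ => add_comm _ _

theorem norm_unitStepSum_le {d : ℕ} (f : lp (fun _ : Fin d → ℤ => ℝ) 2) :
    ‖unitStepSum d f‖ ≤ 2 * d * ‖f‖ := by
  rw [unitStepSum, LinearMap.sum_apply]
  refine (norm_sum_le_of_le univ (f := fun i => _) (n := fun _ => 2 * ‖f‖) fun i _ => ?_).trans ?_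
  · rw [LinearMap.add_apply]
    refine (norm_add_le _ _).trans ?_
    rw [norm_lpTranslate, norm_lpTranslate, two_mul]
  · simp only [sum_const, card_univ, Fintype.card_fin, nsmul_eq_mul]
    linarith

theorem exists_unitStepSum_pow_le {d : ℕ} (hd : 0 < d) (f : lp (fun _ : Fin d → ℤ => ℝ) 2)
    (hf : ∀ x, 0 ≤ f x) (N : ℕ) :
    ∃ g : lp (fun _ : Fin d → ℤ => ℝ) 2,
      (∀ k < N, ∀ x, ((unitStepSum d ^ k) f) x ≤ (2 * d) ^ k * g x) ∧ (∀ x, 0 ≤ g x) ∧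
        ‖g‖ ≤ 4 * ‖f‖ := by
  have hd' : (0 : ℝ) < 2 * d := by positivity
  obtain ⟨g, h, h', h''⟩ := exists_pow_le_norm_le_four ((2 * d : ℝ)⁻¹ • unitStepSum d)
    (fun u v => by
      simp only [LinearMap.smul_apply, real_inner_smul_left, real_inner_smul_right,
        inner_unitStepSum])
    (fun u => by
      rw [LinearMap.smul_apply, norm_smul, Real.norm_of_nonneg (by positivity),
        inv_mul_le_iff₀ hd']
      exact norm_unitStepSum_le u)
    (fun u hu x => by
      rw [LinearMap.smul_apply, lp.coeFn_smul, Pi.smul_apply, unitStepSum_apply, smul_eq_mul]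
      exact mul_nonneg (by positivity) (sum_nonneg fun i _ => add_nonneg (hu _) (hu _)))
    f hf N
  refine ⟨g, fun k hk x => ?_, h', h''⟩
  have := h k hk x
  rwa [smul_pow, LinearMap.smul_apply, lp.coeFn_smul, Pi.smul_apply, smul_eq_mul, inv_pow,
    inv_mul_le_iff₀ (by positivity)] at this


/-- The vectors of `{-1, 0, 1}^d` with exactly `s` nonzero entries. -/
def signVectors (d s : ℕ) : Finset (Fin d → ℤ) :=
  (Fintype.piFinset fun _ => Finset.Icc (-1) 1).filter fun u => ∑ i, (u i).natAbs = s

theorem mem_signVectors {d s : ℕ} {u : Fin d → ℤ} :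
    u ∈ signVectors d s ↔ (∀ i, -1 ≤ u i ∧ u i ≤ 1) ∧ ∑ i, (u i).natAbs = s := by
  simp [signVectors]

theorem sum_signVectors_eq_one {d : ℕ} (s : ℕ) (i : Fin d) {ε : ℤ} (hε : ε = 1 ∨ ε = -1)
    (φ : (Fin d → ℤ) → ℝ) :
    ∑ u ∈ signVectors d (s + 1) with u i = ε, φ u =
      ∑ u ∈ signVectors d s with u i = 0, φ (u + Pi.single i ε) := by
  symm
  have key : ∀ (u : Fin d → ℤ) (c : ℤ), ∑ j, (Function.update u i c j).natAbs + (u i).natAbs =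
      ∑ j, (u j).natAbs + c.natAbs := by
    intro u c
    rw [← add_sum_erase univ _ (mem_univ i),
      ← add_sum_erase univ (fun j => (u j).natAbs) (mem_univ i)]
    rw [sum_congr (g := fun j => (u j).natAbs) rfl]
    · simp; ring
    · intro j hj
      rw [Function.update_of_ne (ne_of_mem_erase hj)]
  have hε1 : ε.natAbs = 1 := by rcases hε with rfl | rfl <;> rfl
  have hadd : ∀ u : Fin d → ℤ, u i = 0 → u + Pi.single i ε = Function.update u i ε := by
    intro u hu
    ext j
    by_cases hj : j = i
    · subst hj; simp [hu]
    · simp [hj]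
  refine sum_nbij' (fun u => Function.update u i ε) (fun u => Function.update u i 0) ?_ ?_ ?_ ?_ ?_
  · intro u hu
    rw [mem_filter, mem_signVectors] at hu ⊢
    obtain ⟨⟨h1, h2⟩, h3⟩ := hu
    refine ⟨⟨fun j => ?_, ?_⟩, by simp⟩
    · by_cases hj : j = i
      · subst hj; rcases hε with rfl | rfl <;> simp
      · simpa [hj] using h1 j
    · have := key u ε
      rw [h3, hε1] at this
      simpa [h2] using this
  · intro u hu
    rw [mem_filter, mem_signVectors] at hu ⊢
    obtain ⟨⟨h1, h2⟩, h3⟩ := hu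
    refine ⟨⟨fun j => ?_, ?_⟩, by simp⟩
    · by_cases hj : j = i
      · subst hj; simp
      · simpa [hj] using h1 j
    · have := key u 0
      rw [h3, hε1, h2] at this
      simpa using this
  · intro u hu
    simp [← (mem_filter.1 hu).2]
  · intro u hu
    simp [← (mem_filter.1 hu).2]
  · intro u hu
    rw [hadd u (mem_filter.1 hu).2]

theorem succ_mul_sum_signVectors {d : ℕ} (s : ℕ) (φ : (Fin d → ℤ) → ℝ) :
    (s + 1) * ∑ u ∈ signVectors d (s + 1), φ u =
      ∑ i, ∑ u ∈ signVectors d s with u i = 0,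
        (φ (u + Pi.single i 1) + φ (u + Pi.single i (-1))) := by
  have h : ∀ i : Fin d, ∑ u ∈ signVectors d s with u i = 0,
        (φ (u + Pi.single i 1) + φ (u + Pi.single i (-1))) =
      ∑ u ∈ signVectors d (s + 1), ((u i).natAbs : ℝ) * φ u := by
    intro i
    rw [sum_add_distrib, ← sum_signVectors_eq_one s i (Or.inl rfl),
      ← sum_signVectors_eq_one s i (Or.inr rfl), sum_filter, sum_filter, ← sum_add_distrib]
    refine sum_congr rfl fun u hu => ?_
    have := (mem_signVectors.1 hu).1 i
    obtain h | h | h : u i = -1 ∨ u i = 0 ∨ u i = 1 := by lia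
    all_goals simp [h]
  rw [sum_congr rfl fun i _ => h i, sum_comm, mul_sum]
  refine sum_congr rfl fun u hu => ?_
  rw [← sum_mul, ← Nat.cast_sum, (mem_signVectors.1 hu).2]
  push_cast
  rfl

theorem factorial_mul_card_signVectors (d s : ℕ) :
    s.factorial * (signVectors d s).card = 2 ^ s * d.descFactorial s := by
  induction s with
  | zero =>
    have : signVectors d 0 = {0} := by
      ext u
      rw [mem_signVectors, mem_singleton]
      constructor
      · rintro ⟨-, h⟩
        ext i
        simpa using (sum_eq_zero_iff.1 h) i (mem_univ i)
      · rintro rfl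
        simp
    simp [this]
  | succ s ih =>
    have h := succ_mul_sum_signVectors (d := d) s fun _ => 1
    have h2 : ∀ u ∈ signVectors d s, (univ.filter fun i => u i = 0).card = d - s := by
      intro u hu
      obtain ⟨h1, h2⟩ := mem_signVectors.1 hu
      have h3 : (univ.filter fun i => ¬ u i = 0).card = s := by
        rw [card_filter, ← h2]
        refine sum_congr rfl fun i _ => ?_
        have := h1 i
        obtain h | h | h : u i = -1 ∨ u i = 0 ∨ u i = 1 := by lia
        all_goals simp [h]
      have h4 := card_filter_add_card_filter_not (s := (univ : Finset (Fin d))) (fun i => u i = 0)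
      rw [h3, card_univ, Fintype.card_fin] at h4
      lia
    have h5 : (s + 1) * (signVectors d (s + 1)).card = 2 * (d - s) * (signVectors d s).card := by
      have e : ∑ i : Fin d, ∑ u ∈ signVectors d s with u i = 0, ((1 : ℝ) + 1) =
          ∑ u ∈ signVectors d s, ∑ i : Fin d with u i = 0, 2 := by
        simp only [sum_filter]
        rw [sum_comm]
        norm_num
      have e' : ∑ u ∈ signVectors d s, ∑ i : Fin d with u i = 0, (2 : ℝ) =
          ∑ u ∈ signVectors d s, ((d - s : ℕ) : ℝ) * 2 :=
        sum_congr rfl fun u hu => by rw [sum_const, h2 u hu, nsmul_eq_mul]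
      rw [e, e'] at h
      simp only [sum_const, nsmul_eq_mul, mul_one] at h
      have : (((s + 1) * (signVectors d (s + 1)).card : ℕ) : ℝ) =
          (2 * (d - s) * (signVectors d s).card : ℕ) := by
        push_cast at h ⊢
        linarith
      exact_mod_cast this
    rw [Nat.factorial_succ, Nat.descFactorial_succ]
    calc (s + 1) * s.factorial * (signVectors d (s + 1)).card
        = s.factorial * ((s + 1) * (signVectors d (s + 1)).card) := by ring
      _ = 2 * (d - s) * (s.factorial * (signVectors d s).card) := by rw [h5]; ring
      _ = _ := by rw [ih]; ring

theorem pow_le_two_mul_descFactorial {d t : ℕ} (h : t ^ 2 ≤ d) :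
    d ^ t ≤ 2 * d.descFactorial t := by
  rcases Nat.eq_zero_or_pos d with rfl | hd
  · obtain rfl : t = 0 := by nlinarith
    simp
  have key : ∀ s : ℕ, s ≤ d → (d : ℝ) ^ s * (1 - s * (s - 1) / (2 * d)) ≤ d.descFactorial s := by
    intro s
    induction s with
    | zero => simp
    | succ s ih =>
      intro hs
      have hs' : (s : ℝ) + 1 ≤ d := by exact_mod_cast hs
      have hd' : (0 : ℝ) < d := by exact_mod_cast hd
      rw [Nat.descFactorial_succ, Nat.cast_mul, Nat.cast_sub (by lia)]
      refine le_trans ?_ (mul_le_mul_of_nonneg_left (ih (by lia)) (by linarith))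
      have e : ((d : ℝ) - s) * (d ^ s * (1 - s * (s - 1) / (2 * d))) -
          d ^ (s + 1) * (1 - (s + 1 : ℕ) * ((s + 1 : ℕ) - 1) / (2 * d)) =
          d ^ s * (s * (s * (s - 1))) / (2 * d) := by
        push_cast
        field_simp
        ring
      have : 0 ≤ (d : ℝ) ^ s * (s * (s * (s - 1))) / (2 * d) := by
        rcases Nat.eq_zero_or_pos s with rfl | h0
        · simp
        · have : (1 : ℝ) ≤ s := by exact_mod_cast h0
          have : 0 ≤ (s : ℝ) - 1 := by linarith
          positivity
      linarith
  have hk := key t (by nlinarith)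
  have h1 : (t : ℝ) * (t - 1) / (2 * d) ≤ 1 / 2 := by
    have : (t : ℝ) ^ 2 ≤ d := by exact_mod_cast h
    rw [div_le_iff₀ (by positivity)]
    nlinarith [(Nat.cast_nonneg t : (0 : ℝ) ≤ t)]
  have : (d : ℝ) ^ t ≤ 2 * d.descFactorial t := by
    have : (d : ℝ) ^ t * (1 / 2) ≤ (d : ℝ) ^ t * (1 - t * (t - 1) / (2 * d)) := by
      gcongr
      linarith
    linarith
  exact_mod_cast this

theorem latticeBall_eq (d t : ℕ) (y : Fin d → ℤ) :
    y ∈ latticeBall d t ↔ ∑ i, (y i).natAbs ≤ t := by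
  have e : ∑ i, |y i| ≤ (t : ℤ) ↔ ∑ i, (y i).natAbs ≤ t := by
    rw [← Nat.cast_le (α := ℤ)]
    push_cast
    rfl
  rw [latticeBall, mem_filter, e, and_iff_right_iff_imp, mem_Icc, Pi.le_def, Pi.le_def,
    ← forall_and]
  intro h i
  have := single_le_sum (fun j _ => Nat.zero_le (y j).natAbs) (mem_univ i)
  lia

theorem pow_le_card_latticeBall {d t : ℕ} (h : t ^ 2 ≤ d) :
    ((2 * d) ^ t : ℝ) ≤ 2 * t.factorial * (latticeBall d t).card := by
  have h1 : (signVectors d t).card ≤ (latticeBall d t).card :=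
    card_le_card fun u hu => (latticeBall_eq d t u).2 (mem_signVectors.1 hu).2.le
  have h2 : (2 * d) ^ t ≤ 2 * t.factorial * (latticeBall d t).card :=
    calc (2 * d) ^ t = 2 ^ t * d ^ t := mul_pow _ _ _
      _ ≤ 2 ^ t * (2 * d.descFactorial t) := by
        gcongr; exact pow_le_two_mul_descFactorial h
      _ = 2 * (t.factorial * (signVectors d t).card) := by
        rw [factorial_mul_card_signVectors]; ring
      _ ≤ 2 * (t.factorial * (latticeBall d t).card) := by gcongr
      _ = _ := by ring
  exact_mod_cast h2

theorem factorial_mul_sum_signVectors_le {d : ℕ} (f : lp (fun _ : Fin d → ℤ => ℝ) 2)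
    (hf : ∀ x, 0 ≤ f x) (s : ℕ) (x : Fin d → ℤ) :
    s.factorial * ∑ u ∈ signVectors d s, f (x - u) ≤ (unitStepSum d ^ s) f x := by
  induction s generalizing x with
  | zero =>
    have : signVectors d 0 ⊆ {0} := fun u hu => by
      have h := (mem_signVectors.1 hu).2
      rw [mem_singleton]
      ext i
      simpa using (sum_eq_zero_iff.1 h) i (mem_univ i)
    simpa using sum_le_sum_of_subset_of_nonneg this fun u _ _ => hf (x - u)
  | succ s ih =>
    rw [pow_succ', Module.End.mul_apply, unitStepSum_apply, Nat.factorial_succ]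
    push_cast
    rw [mul_comm ((s : ℝ) + 1), mul_assoc, succ_mul_sum_signVectors s fun u => f (x - u), mul_sum]
    refine sum_le_sum fun i _ => ?_
    refine le_trans ?_ (add_le_add (ih _) (ih _))
    rw [← mul_add, ← sum_add_distrib]
    gcongr
    have e : ∀ u : Fin d → ℤ, f (x - (u + Pi.single i 1)) + f (x - (u + Pi.single i (-1))) =
        f (x - Pi.single i 1 - u) + f (x + Pi.single i 1 - u) := by
      intro u
      rw [Pi.single_neg, show x - (u + Pi.single i 1) = x - Pi.single i 1 - u by abel,
        show x - (u + -Pi.single i 1) = x + Pi.single i 1 - u by abel]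
    simp_rw [e]
    exact sum_le_sum_of_subset_of_nonneg (filter_subset _ _)
      fun u _ _ => add_nonneg (hf _) (hf _)

/-- The vectors of `ℤ^d` with entries in `[-T, T] \ {-1, 1}`. -/
def gapVectors (d T : ℕ) : Finset (Fin d → ℤ) :=
  Fintype.piFinset fun _ => (Finset.Icc (-(T : ℤ)) T).filter fun a => a.natAbs ≠ 1

theorem mem_gapVectors {d T : ℕ} {z : Fin d → ℤ} :
    z ∈ gapVectors d T ↔ ∀ i, (z i).natAbs ≤ T ∧ (z i).natAbs ≠ 1 := by
  rw [gapVectors, Fintype.mem_piFinset]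
  refine forall_congr' fun i => ?_
  rw [mem_filter, mem_Icc]
  lia

theorem sum_latticeBall_le {d t T : ℕ} (ht : t ≤ T) (φ : (Fin d → ℤ) → ℝ) (hφ : ∀ y, 0 ≤ φ y) :
    ∑ y ∈ latticeBall d t, φ y ≤
      ∑ z ∈ gapVectors d T, ∑ s ∈ range (t + 1) with s + ∑ i, (z i).natAbs ≤ t,
        ∑ u ∈ signVectors d s, φ (z + u) := by
  classical
  let u : (Fin d → ℤ) → Fin d → ℤ := fun y i => if (y i).natAbs = 1 then y i else 0
  let z : (Fin d → ℤ) → Fin d → ℤ := fun y i => if (y i).natAbs = 1 then 0 else y i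
  have hzu : ∀ y, z y + u y = y := by
    intro y
    ext i
    by_cases h : (y i).natAbs = 1 <;> simp [z, u, h]
  have hsum : ∀ y, ∑ i, (u y i).natAbs + ∑ i, (z y i).natAbs = ∑ i, (y i).natAbs := by
    intro y
    rw [← sum_add_distrib]
    refine sum_congr rfl fun i _ => ?_
    by_cases h : (y i).natAbs = 1 <;> simp [z, u, h]
  let F : (Fin d → ℤ) → (_ : Fin d → ℤ) × (_ : ℕ) × (Fin d → ℤ) :=
    fun y => ⟨z y, ∑ i, (u y i).natAbs, u y⟩
  have hF : Set.InjOn F (latticeBall d t) := by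
    intro y _ y' _ h
    have h1 := congrArg (fun p => p.1 + p.2.2) h
    simpa [F, hzu] using h1
  have e : ∑ y ∈ latticeBall d t, φ y = ∑ p ∈ (latticeBall d t).image F, φ (p.1 + p.2.2) := by
    rw [sum_image hF]
    simp [F, hzu]
  rw [e]
  simp_rw [sum_sigma']
  refine sum_le_sum_of_subset_of_nonneg ?_ fun _ _ _ => hφ _
  intro p hp
  obtain ⟨y, hy, rfl⟩ := mem_image.1 hp
  rw [latticeBall_eq, ← hsum] at hy
  have hle : ∀ i, (z y i).natAbs ≤ T := fun i => by
    have := single_le_sum (fun j _ => Nat.zero_le (z y j).natAbs) (mem_univ i)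
    lia
  rw [mem_sigma, mem_sigma, mem_filter, mem_range, mem_gapVectors, mem_signVectors]
  refine ⟨fun i => ⟨hle i, ?_⟩, ⟨?_, hy⟩, fun i => ?_, rfl⟩
  · by_cases h : (y i).natAbs = 1 <;> simp [F, z, h]
  · change ∑ i, (u y i).natAbs < t + 1
    lia
  · change -1 ≤ u y i ∧ u y i ≤ 1
    simp only [u]
    split_ifs <;> lia

theorem sum_range_pow_le_two {r : ℝ} (h0 : 0 ≤ r) (h : r ≤ 1 / 2) (n : ℕ) :
    ∑ j ∈ range n, r ^ j ≤ 2 := by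
  have h1 : ∑ j ∈ range n, r ^ j ≤ (1 - r)⁻¹ := by
    rw [← tsum_geometric_of_lt_one h0 (by linarith)]
    exact (summable_geometric_of_lt_one h0 (by linarith)).sum_le_tsum _ fun j _ => by positivity
  refine h1.trans ?_
  rw [inv_le_comm₀ (by linarith) two_pos]
  linarith

theorem sum_gapVectors_pow_le {d T : ℕ} {r : ℝ} (h0 : 0 ≤ r) (h : r ≤ 1 / 2)
    (hr : 4 * r ^ 2 * d ≤ 1) :
    ∑ z ∈ gapVectors d T, r ^ (∑ i, (z i).natAbs) ≤ 3 := by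
  have h1 : ∑ a ∈ Finset.Icc (-(T : ℤ)) T with a.natAbs ≠ 1, r ^ a.natAbs ≤ 4 * r ^ 2 + 1 := by
    have hsub : (Finset.Icc (-(T : ℤ)) T).filter (fun a => a.natAbs ≠ 1) ⊆
        insert 0 ((range T).image (fun j : ℕ => (j + 2 : ℤ)) ∪
          (range T).image (fun j : ℕ => -(j + 2 : ℤ))) := by
      intro a ha
      rw [mem_filter, mem_Icc] at ha
      simp only [mem_insert, mem_union, mem_image, mem_range]
      rcases lt_trichotomy a 0 with h | h | h
      · exact Or.inr (Or.inr ⟨(-a - 2).toNat, by lia, by lia⟩)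
      · exact Or.inl h
      · exact Or.inr (Or.inl ⟨(a - 2).toNat, by lia, by lia⟩)
    refine (sum_le_sum_of_subset_of_nonneg hsub fun _ _ _ => by positivity).trans ?_
    have hg := sum_range_pow_le_two h0 h T
    have e1 : ∑ a ∈ (range T).image (fun j : ℕ => (j + 2 : ℤ)), r ^ a.natAbs =
        r ^ 2 * ∑ j ∈ range T, r ^ j := by
      rw [sum_image (fun a _ b _ h => by simpa using h), mul_sum]
      refine sum_congr rfl fun j _ => ?_
      rw [← pow_add]
      congr 1
      lia
    have e2 : ∑ a ∈ (range T).image (fun j : ℕ => -(j + 2 : ℤ)), r ^ a.natAbs =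
        r ^ 2 * ∑ j ∈ range T, r ^ j := by
      rw [sum_image (fun a _ b _ h => by simpa using h), mul_sum]
      refine sum_congr rfl fun j _ => ?_
      rw [← pow_add]
      congr 1
      lia
    rw [sum_insert (by simp; lia)]
    have hu := sum_union_inter (s₁ := (range T).image (fun j : ℕ => (j + 2 : ℤ)))
      (s₂ := (range T).image (fun j : ℕ => -(j + 2 : ℤ))) (f := fun a : ℤ => r ^ a.natAbs)
    have hi : 0 ≤ ∑ a ∈ (range T).image (fun j : ℕ => (j + 2 : ℤ)) ∩
        (range T).image (fun j : ℕ => -(j + 2 : ℤ)), r ^ a.natAbs :=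
      sum_nonneg fun _ _ => by positivity
    rw [e1, e2] at hu
    simp only [Int.natAbs_zero, pow_zero]
    nlinarith [sq_nonneg r]
  have e : ∑ z ∈ gapVectors d T, r ^ (∑ i, (z i).natAbs) =
      (∑ a ∈ Finset.Icc (-(T : ℤ)) T with a.natAbs ≠ 1, r ^ a.natAbs) ^ d := by
    have := (prod_univ_sum (fun _ : Fin d => (Finset.Icc (-(T : ℤ)) T).filter fun a => a.natAbs ≠ 1)
      (fun _ a => r ^ a.natAbs)).symm
    simp only [prod_pow_eq_pow_sum] at this
    rw [gapVectors, this]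
    simp
  rw [e]
  calc _ ≤ (4 * r ^ 2 + 1) ^ d := by gcongr
    _ ≤ (Real.exp (4 * r ^ 2)) ^ d := by gcongr; exact Real.add_one_le_exp _
    _ = Real.exp (4 * r ^ 2 * d) := by rw [← Real.exp_nat_mul]; ring_nf
    _ ≤ Real.exp 1 := Real.exp_le_exp.2 hr
    _ ≤ 3 := by linarith [Real.exp_one_lt_d9]

theorem sum_latticeBall_le_sum_gapVectors {d t T : ℕ} (hd : 0 < d) (ht : t ≤ T) (htd : t ^ 2 ≤ d)
    {r : ℝ} (h0 : 0 ≤ r) (h : r ≤ 1 / 2) (hr : t ≤ r * (2 * d))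
    (f g : lp (fun _ : Fin d → ℤ => ℝ) 2) (hf : ∀ x, 0 ≤ f x) (hg : ∀ x, 0 ≤ g x)
    (hfg : ∀ k < T + 1, ∀ x, ((unitStepSum d ^ k) f) x ≤ (2 * d) ^ k * g x) (x : Fin d → ℤ) :
    ((latticeBall d t).card : ℝ)⁻¹ * ∑ y ∈ latticeBall d t, f (x - y) ≤
      4 * ∑ z ∈ gapVectors d T, r ^ (∑ i, (z i).natAbs) * g (x - z) := by
  have hd' : (0 : ℝ) < 2 * d := by positivity
  have hcard := pow_le_card_latticeBall htd
  have hpos : (0 : ℝ) < (latticeBall d t).card := by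
    by_contra! hle
    have : (0 : ℝ) < (2 * d) ^ t := by positivity
    nlinarith [(Nat.cast_nonneg t.factorial : (0 : ℝ) ≤ t.factorial)]
  rw [inv_mul_le_iff₀ hpos]
  refine (sum_latticeBall_le ht (fun y => f (x - y)) fun y => hf _).trans ?_
  rw [mul_sum, mul_sum]
  refine sum_le_sum fun z _ => ?_
  set m := ∑ i, (z i).natAbs with hm
  have hterm : ∀ s ∈ (range (t + 1)).filter (fun s => s + m ≤ t),
      ∑ u ∈ signVectors d s, f (x - (z + u)) ≤
        2 * (latticeBall d t).card * g (x - z) * r ^ (t - s) := by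
    intro s hs
    rw [mem_filter, mem_range] at hs
    have h1 := factorial_mul_sum_signVectors_le f hf s (x - z)
    have h2 := hfg s (by lia) (x - z)
    have h3 : (t.factorial : ℝ) ≤ s.factorial * t ^ (t - s) := by
      have := Nat.factorial_mul_descFactorial (n := t) (k := t - s) (by lia)
      rw [Nat.sub_sub_self (by lia)] at this
      rw [← this]
      have := Nat.descFactorial_le_pow t (t - s)
      exact_mod_cast Nat.mul_le_mul_left _ this
    have h4 : (t : ℝ) ^ (t - s) ≤ r ^ (t - s) * (2 * d) ^ (t - s) := by
      rw [← mul_pow]; gcongr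
    have h5 : (2 * d : ℝ) ^ s ≤ s.factorial * (2 * (latticeBall d t).card * r ^ (t - s)) := by
      have e : (2 * d : ℝ) ^ t = (2 * d) ^ s * (2 * d) ^ (t - s) := by
        rw [← pow_add]; congr 1; lia
      refine le_of_mul_le_mul_right ?_ (by positivity : (0 : ℝ) < (2 * d) ^ (t - s))
      rw [← e]
      calc (2 * d : ℝ) ^ t ≤ 2 * t.factorial * (latticeBall d t).card := hcard
        _ ≤ 2 * (s.factorial * (r ^ (t - s) * (2 * d) ^ (t - s))) * (latticeBall d t).card := by
          gcongr
          exact h3.trans (by gcongr)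
        _ = _ := by ring
    have h6 : (0 : ℝ) < s.factorial := by positivity
    refine le_of_mul_le_mul_left ?_ h6
    simp only [← sub_sub]
    calc _ ≤ _ := h1
      _ ≤ _ := h2
      _ ≤ s.factorial * (2 * (latticeBall d t).card * r ^ (t - s)) * g (x - z) := by
        gcongr; exact hg _
      _ = _ := by ring
  refine (sum_le_sum hterm).trans ?_
  rw [← mul_sum]
  have hgeo : ∑ s ∈ (range (t + 1)).filter (fun s => s + m ≤ t), r ^ (t - s) ≤ 2 * r ^ m := by
    by_cases hmt : m ≤ t
    · have e : (range (t + 1)).filter (fun s => s + m ≤ t) = range (t - m + 1) := by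
        ext s
        rw [mem_filter, mem_range, mem_range]
        lia
      have e2 : ∀ s ∈ range (t - m + 1), r ^ (t - s) = r ^ m * r ^ (t - m + 1 - 1 - s) := by
        intro s hs
        rw [mem_range] at hs
        rw [← pow_add]
        congr 1
        lia
      rw [e, sum_congr rfl e2, ← mul_sum, sum_range_reflect (fun j => r ^ j)]
      nlinarith [sum_range_pow_le_two h0 h (t - m + 1), pow_nonneg h0 m]
    · rw [filter_false_of_mem fun s _ => by lia]
      simp only [sum_empty]
      positivity
  calc _ ≤ 2 * ((latticeBall d t).card : ℝ) * g (x - z) * (2 * r ^ m) := by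
        gcongr
        exact mul_nonneg (by positivity) (hg _)
    _ = _ := by ring

theorem tsum_enorm_rpow_eq {G E : Type*} [NormedAddCommGroup E] (f : lp (fun _ : G => E) 2) :
    (∑' x, (‖f x‖₊ : ℝ≥0∞) ^ (2 : ℝ)) ^ ((1 : ℝ) / 2) = ENNReal.ofReal ‖f‖ := by
  have h := lp.norm_rpow_eq_tsum (p := 2) (by norm_num) f
  have hs := (memℓp_gen_iff (p := 2) (by norm_num)).1 (lp.memℓp f)
  simp only [ENNReal.toReal_ofNat] at h hs
  have e : ∀ x, (‖f x‖₊ : ℝ≥0∞) ^ (2 : ℝ) = ENNReal.ofReal (‖f x‖ ^ (2 : ℝ)) := by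
    intro x
    rw [← ENNReal.ofReal_rpow_of_nonneg (norm_nonneg _) (by norm_num), ofReal_norm]
    rfl
  simp_rw [e]
  rw [← ENNReal.ofReal_tsum_of_nonneg (fun x => by positivity) hs, ← h,
    ← ENNReal.ofReal_rpow_of_nonneg (norm_nonneg _) (by norm_num), ← ENNReal.rpow_mul]
  norm_num

theorem exists_norm_Mop_le {d : ℕ} (hd : 4 ≤ d) (f : lp (fun _ : Fin d → ℤ => ℂ) 2) :
    ∃ g : lp (fun _ : Fin d → ℤ => ℝ) 2,
      (∀ t : ℕ, t ^ 2 ≤ d → ∀ x, ‖Mop d t f x‖ ≤ g x) ∧ ‖g‖ ≤ 48 * ‖f‖ := by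
  have hd0 : (0 : ℝ) < d := by exact_mod_cast (by lia : 0 < d)
  set r : ℝ := 1 / (2 * Real.sqrt d) with hr
  have hsq : (2 : ℝ) ≤ Real.sqrt d := Real.le_sqrt_of_sq_le (by norm_num; exact_mod_cast hd)
  have hsd : Real.sqrt d * Real.sqrt d = d := Real.mul_self_sqrt hd0.le
  have h0 : 0 ≤ r := by positivity
  have h1 : r ≤ 1 / 2 := by
    rw [hr]
    gcongr
    linarith
  have hrd : r * (2 * d) = Real.sqrt d := by
    rw [hr]
    field_simp
    linarith
  have hr2 : 4 * r ^ 2 * d ≤ 1 := by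
    have : 2 * r * Real.sqrt d = 1 := by rw [hr]; field_simp
    nlinarith
  have hmem : Memℓp (fun x => ‖f x‖) 2 := by
    have h := lp.memℓp f
    rw [memℓp_gen_iff (by norm_num)] at h ⊢
    simpa using h
  let F : lp (fun _ : Fin d → ℤ => ℝ) 2 := ⟨_, hmem⟩
  have hF : ∀ x, F x = ‖f x‖ := fun _ => rfl
  have hFnorm : ‖F‖ = ‖f‖ := by
    have e1 := tsum_enorm_rpow_eq F
    have e2 := tsum_enorm_rpow_eq f
    simp only [hF, nnnorm_norm] at e1
    rw [e1, ENNReal.ofReal_eq_ofReal_iff (norm_nonneg _) (norm_nonneg _)] at e2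
    exact e2
  have hF0 : ∀ x, 0 ≤ F x := fun x => by rw [hF]; positivity
  obtain ⟨g, hg, hg0, hgn⟩ := exists_unitStepSum_pow_le (by lia : 0 < d) F hF0 (Nat.sqrt d + 1)
  refine ⟨(4 : ℝ) • ∑ z ∈ gapVectors d (Nat.sqrt d),
    (r ^ (∑ i, (z i).natAbs)) • lpTranslate z g, fun t ht x => ?_, ?_⟩
  · have htT : t ≤ Nat.sqrt d := Nat.le_sqrt'.2 ht
    have htr : (t : ℝ) ≤ r * (2 * d) := by
      rw [hrd]
      exact Real.le_sqrt_of_sq_le (by exact_mod_cast ht)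
    have h := sum_latticeBall_le_sum_gapVectors (by lia) htT ht h0 h1 htr F g hF0 hg0 hg x
    rw [lp.coeFn_smul, Pi.smul_apply, lp.coeFn_sum, Finset.sum_apply, smul_eq_mul]
    simp only [lp.coeFn_smul, Pi.smul_apply, lpTranslate_apply, smul_eq_mul]
    refine le_trans ?_ h
    rw [Mop, norm_mul, norm_inv, Complex.norm_natCast]
    gcongr
    exact norm_sum_le _ _
  · rw [norm_smul, Real.norm_of_nonneg (by norm_num)]
    have h2 : ‖∑ z ∈ gapVectors d (Nat.sqrt d), (r ^ (∑ i, (z i).natAbs)) • lpTranslate z g‖ ≤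
        3 * ‖g‖ := by
      refine le_trans ?_ (mul_le_mul_of_nonneg_right
        (sum_gapVectors_pow_le (T := Nat.sqrt d) h0 h1 hr2) (norm_nonneg g))
      rw [sum_mul]
      refine norm_sum_le_of_le _ fun z _ => ?_
      rw [norm_smul, norm_lpTranslate, Real.norm_of_nonneg (by positivity)]
    rw [hFnorm] at hgn
    linarith

/-- Theorem 1.3: for `d ≥ 4` and `f ∈ l²(ℤ^d)`,
`‖ sup_{t ∈ 𝔻, t ≤ √d} |𝓜_t f| ‖_{l²(ℤ^d)} ≤ 900 ‖f‖_{l²(ℤ^d)}`. -/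
theorem dyadic_maximal_l1ball_l2_bound (d : ℕ) (hd : 4 ≤ d)
    (f : (Fin d → ℤ) → ℂ) (hf : Memℓp f 2) :
    (∑' x : Fin d → ℤ,
        (⨆ (n : ℕ) (_ : ((2 ^ n : ℕ) : ℝ) ≤ Real.sqrt d),
          (‖Mop d (2 ^ n) f x‖₊ : ℝ≥0∞)) ^ (2 : ℝ)) ^ ((1 : ℝ) / 2)
      ≤ 900 * (∑' x : Fin d → ℤ, (‖f x‖₊ : ℝ≥0∞) ^ (2 : ℝ)) ^ ((1 : ℝ) / 2) := by
  obtain ⟨g, hg, hgn⟩ := exists_norm_Mop_le hd ⟨f, hf⟩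
  have hle : ∀ x, (⨆ (n : ℕ) (_ : ((2 ^ n : ℕ) : ℝ) ≤ Real.sqrt d),
      (‖Mop d (2 ^ n) f x‖₊ : ℝ≥0∞)) ≤ (‖g x‖₊ : ℝ≥0∞) := by
    refine fun x => iSup₂_le fun n hn => ?_
    have ht : (2 ^ n) ^ 2 ≤ d := by
      rw [Real.le_sqrt' (by positivity)] at hn
      exact_mod_cast hn
    have := (hg _ ht x).trans (le_abs_self _)
    exact_mod_cast this
  calc _ ≤ (∑' x, (‖g x‖₊ : ℝ≥0∞) ^ (2 : ℝ)) ^ ((1 : ℝ) / 2) := by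
        gcongr with x
        exact hle x
    _ = ENNReal.ofReal ‖g‖ := tsum_enorm_rpow_eq g
    _ ≤ ENNReal.ofReal (900 * ‖(⟨f, hf⟩ : lp (fun _ : Fin d → ℤ => ℂ) 2)‖) :=
        ENNReal.ofReal_le_ofReal (by
          linarith [norm_nonneg (⟨f, hf⟩ : lp (fun _ : Fin d → ℤ => ℂ) 2)])
    _ = _ := by
        rw [ENNReal.ofReal_mul (by norm_num), ← tsum_enorm_rpow_eq]
        norm_num
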